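/- arXiv:1009.4814 — 3 statements merged into one kernel-verified Lean document; each statement's English description precedes it below -/
import Mathlib

section
/- Let ν₀ ≈ 1.373318506 be the unique positive root of the cubic equation 8ν³ - 9ν² - 2ν - 1 = 0. Then for every ν ≥ ν₀, the function u ↦ u²·I_ν'(u)/I_ν(u)² is strictly decreasing on (0, ∞). -/
open Real MeasureTheory Set

/-- The modified Bessel function of the first kind of order `ν`. -/
noncomputable def besselI (ν u : ℝ) : ℝ :=
  ∑' n : ℕ, (u / 2) ^ (2 * (n : ℝ) + ν) / ((n.factorial : ℝ) * Real.Gamma ((n : ℝ) + ν + 1))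

/-- The entire function `x ↦ ∑ xⁿ / (n! Γ(n + ν + 1))`, so that
`besselI ν u = (u / 2) ^ ν * besselEntire ν (u ^ 2 / 4)` for `0 < u`. -/
noncomputable def besselEntire (ν x : ℝ) : ℝ :=
  ∑' n : ℕ, x ^ n / ((n.factorial : ℝ) * Real.Gamma ((n : ℝ) + ν + 1))

lemma Gamma_le_Gamma_natCast_add {s : ℝ} (hs : 1 ≤ s) (n : ℕ) :
    Real.Gamma s ≤ Real.Gamma (n + s) := by
  induction n with
  | zero => simp
  | succ n ih =>
    have h1 : (1 : ℝ) ≤ n + s := by have := n.cast_nonneg (α := ℝ); linarith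
    have h2 : ((n + 1 : ℕ) : ℝ) + s = (n + s) + 1 := by push_cast; ring
    rw [h2, Real.Gamma_add_one (by linarith)]
    have := Real.Gamma_pos_of_pos (by linarith : (0 : ℝ) < n + s)
    nlinarith

lemma norm_besselEntire_term_le {ν : ℝ} (hν : 0 ≤ ν) (x : ℝ) (n : ℕ) :
    ‖x ^ n / ((n.factorial : ℝ) * Real.Gamma ((n : ℝ) + ν + 1))‖ ≤
      |x| ^ n / n.factorial * (Real.Gamma (ν + 1))⁻¹ := by
  have h1 := Real.Gamma_pos_of_pos (by linarith : (0 : ℝ) < ν + 1)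
  have h2 := Gamma_le_Gamma_natCast_add (by linarith : 1 ≤ ν + 1) n
  rw [← add_assoc] at h2
  have h3 : (0 : ℝ) < n.factorial := by positivity
  rw [norm_div, norm_pow, Real.norm_eq_abs, Real.norm_of_nonneg (by nlinarith), ← div_eq_mul_inv,
    div_div]
  gcongr

lemma summable_besselEntire {ν : ℝ} (hν : 0 ≤ ν) (x : ℝ) :
    Summable fun n : ℕ => x ^ n / ((n.factorial : ℝ) * Real.Gamma ((n : ℝ) + ν + 1)) :=
  .of_norm_bounded ((Real.summable_pow_div_factorial |x|).mul_right _)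
    (norm_besselEntire_term_le hν x)

lemma besselEntire_pos {ν x : ℝ} (hν : 0 ≤ ν) (hx : 0 ≤ x) : 0 < besselEntire ν x := by
  have hG (n : ℕ) : 0 < Real.Gamma ((n : ℝ) + ν + 1) := Real.Gamma_pos_of_pos (by positivity)
  refine (summable_besselEntire hν x).tsum_pos (fun n => ?_) 0 ?_
  · have := hG n
    positivity
  · have := hG 0
    rw [pow_zero]
    positivity

lemma besselEntire_deriv_term {ν : ℝ} (y : ℝ) (n : ℕ) :
    ((n + 1 : ℕ) : ℝ) * y ^ n / (((n + 1).factorial : ℝ) * Real.Gamma (((n + 1 : ℕ) : ℝ) + ν + 1)) =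
      y ^ n / ((n.factorial : ℝ) * Real.Gamma ((n : ℝ) + (ν + 1) + 1)) := by
  have h1 : ((n + 1 : ℕ) : ℝ) + ν + 1 = n + (ν + 1) + 1 := by push_cast; ring
  have h2 : ((n + 1 : ℕ) : ℝ) ≠ 0 := by positivity
  rw [h1, Nat.factorial_succ, Nat.cast_mul, mul_assoc, mul_div_mul_left _ _ h2]

lemma hasDerivAt_besselEntire {ν : ℝ} (hν : 0 ≤ ν) (x : ℝ) :
    HasDerivAt (besselEntire ν) (besselEntire (ν + 1) x) x := by
  have hν' : 0 ≤ ν + 1 := by linarith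
  let f' (n : ℕ) (y : ℝ) : ℝ :=
    n * y ^ (n - 1) / ((n.factorial : ℝ) * Real.Gamma ((n : ℝ) + ν + 1))
  have hsucc (n : ℕ) (y : ℝ) : f' (n + 1) y =
      y ^ n / ((n.factorial : ℝ) * Real.Gamma ((n : ℝ) + (ν + 1) + 1)) :=
    besselEntire_deriv_term y n
  have hzero (y : ℝ) : f' 0 y = 0 := by simp [f']
  set B := |x| + 1
  let b (n : ℕ) : ℝ :=
    Nat.casesOn n 0 fun m => B ^ m / m.factorial * (Real.Gamma (ν + 1 + 1))⁻¹
  have hb : Summable b := by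
    rw [← summable_nat_add_iff 1]
    exact (Real.summable_pow_div_factorial B).mul_right _
  have hbound (n : ℕ) (y : ℝ) (hy : y ∈ Metric.ball (0 : ℝ) B) : ‖f' n y‖ ≤ b n := by
    cases n with
    | zero => simp [hzero, b]
    | succ n =>
      rw [hsucc]
      refine (norm_besselEntire_term_le hν' y n).trans ?_
      have h1 := Real.Gamma_pos_of_pos (by linarith : (0 : ℝ) < ν + 1 + 1)
      have hyB : |y| ≤ B := by simpa using (mem_ball_zero_iff.1 hy).le
      change _ ≤ B ^ n / n.factorial * (Real.Gamma (ν + 1 + 1))⁻¹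
      gcongr
  have hx : x ∈ Metric.ball (0 : ℝ) B := by simp [B]
  have hderiv := hasDerivAt_tsum_of_isPreconnected hb Metric.isOpen_ball
    (convex_ball (0 : ℝ) B).isPreconnected
    (g := fun (n : ℕ) (y : ℝ) => y ^ n / ((n.factorial : ℝ) * Real.Gamma ((n : ℝ) + ν + 1))) (g' := f')
    (fun n y _ => (hasDerivAt_pow n y).div_const _) hbound hx (summable_besselEntire hν x) hx
  have hsum : ∑' n, f' n x = besselEntire (ν + 1) x := by
    have hs : Summable fun n => f' n x := .of_norm_bounded hb fun n => hbound n x hx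
    rw [hs.tsum_eq_zero_add, hzero, zero_add, besselEntire]
    exact tsum_congr fun n => hsucc n x
  rwa [hsum] at hderiv

lemma besselEntire_recurrence {ν : ℝ} (hν : 0 ≤ ν) (x : ℝ) :
    besselEntire ν x =
      (ν + 1) * besselEntire (ν + 1) x + x * besselEntire (ν + 2) x := by
  have hs := summable_besselEntire hν x
  have hs1 := summable_besselEntire (by linarith : 0 ≤ ν + 1) x
  have hs2 := summable_besselEntire (by linarith : 0 ≤ ν + 2) x
  unfold besselEntire
  rw [hs.tsum_eq_zero_add, hs1.tsum_eq_zero_add, mul_add, ← tsum_mul_left, ← tsum_mul_left,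
    add_assoc (_ * _), ← (((summable_nat_add_iff 1).2 hs1).mul_left _).tsum_add (hs2.mul_left _)]
  congr 1
  · have h := Real.Gamma_pos_of_pos (by linarith : (0 : ℝ) < ν + 1)
    have h2 := Real.Gamma_add_one (by linarith : ν + 1 ≠ 0)
    simp only [pow_zero, Nat.factorial_zero, Nat.cast_one, Nat.cast_zero, zero_add, one_mul, h2]
    field_simp
  · refine tsum_congr fun n => ?_
    have hpos : (0 : ℝ) < n + ν + 2 := by positivity
    have h := Real.Gamma_pos_of_pos hpos
    have h2 := Real.Gamma_add_one hpos.ne'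
    have e1 : ((n + 1 : ℕ) : ℝ) + ν + 1 = n + ν + 2 := by push_cast; ring
    have e2 : ((n + 1 : ℕ) : ℝ) + (ν + 1) + 1 = n + ν + 2 + 1 := by push_cast; ring
    have e3 : (n : ℝ) + (ν + 2) + 1 = n + ν + 2 + 1 := by ring
    rw [e1, e2, e3, h2, Nat.factorial_succ]
    push_cast
    field_simp
    ring

lemma besselI_eq_rpow_mul_besselEntire (ν : ℝ) {u : ℝ} (hu : 0 < u) :
    besselI ν u = (u / 2) ^ ν * besselEntire ν (u ^ 2 / 4) := by
  unfold besselI besselEntire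
  rw [← tsum_mul_left]
  refine tsum_congr fun n => ?_
  have h : (u / 2) ^ (2 * (n : ℝ)) = (u ^ 2 / 4) ^ n := by
    rw [show 2 * (n : ℝ) = ((2 * n : ℕ) : ℝ) by push_cast; ring, Real.rpow_natCast, pow_mul]
    ring
  rw [Real.rpow_add (by positivity), h]
  ring

/-- The logarithmic derivative `u * I_ν'(u) / I_ν(u)` as a function of `x = u ^ 2 / 4`. -/
noncomputable def besselLogDeriv (ν x : ℝ) : ℝ :=
  ν + 2 * x * besselEntire (ν + 1) x / besselEntire ν x

lemma hasDerivAt_sq_div_four (u : ℝ) : HasDerivAt (fun v : ℝ => v ^ 2 / 4) (u / 2) u :=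
  ((hasDerivAt_pow 2 u).div_const 4).congr_deriv (by norm_num; ring)

lemma hasDerivAt_besselI {ν u : ℝ} (hν : 0 ≤ ν) (hu : 0 < u) :
    HasDerivAt (besselI ν) (besselI ν u * besselLogDeriv ν (u ^ 2 / 4) / u) u := by
  have hE := besselEntire_pos hν (by positivity : 0 ≤ u ^ 2 / 4)
  have h1 : HasDerivAt (fun v : ℝ => (v / 2) ^ ν) (1 / 2 * ν * (u / 2) ^ (ν - 1)) u :=
    ((hasDerivAt_id u).div_const 2).rpow_const (Or.inl (by simpa using hu.ne'))
  have h2 := hasDerivAt_sq_div_four u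
  have h3 := h1.mul ((hasDerivAt_besselEntire hν (u ^ 2 / 4)).comp u h2)
  have h4 : besselI ν =ᶠ[nhds u]
      (fun v : ℝ => (v / 2) ^ ν) * (besselEntire ν ∘ fun v : ℝ => v ^ 2 / 4) := by
    filter_upwards [Ioi_mem_nhds hu] with v hv
    exact besselI_eq_rpow_mul_besselEntire ν hv
  refine (h3.congr_of_eventuallyEq h4).congr_deriv ?_
  rw [besselI_eq_rpow_mul_besselEntire ν hu, besselLogDeriv, Real.rpow_sub_one (by positivity),
    Function.comp_apply]
  field_simp
  ring

/-- The Riccati equation for the logarithmic derivative. -/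
lemma hasDerivAt_besselLogDeriv {ν x : ℝ} (hν : 0 ≤ ν) (hx : 0 ≤ x) :
    ∃ d, HasDerivAt (besselLogDeriv ν) d x ∧
      2 * x * d = 4 * x + ν ^ 2 - besselLogDeriv ν x ^ 2 := by
  have hE := besselEntire_pos hν hx
  have hrec := besselEntire_recurrence hν x
  have h1 := hasDerivAt_besselEntire (by linarith : 0 ≤ ν + 1) x
  rw [add_assoc, one_add_one_eq_two] at h1
  refine ⟨_, ((((hasDerivAt_id x).const_mul 2).mul h1).div
    (hasDerivAt_besselEntire hν x) hE.ne').const_add ν, ?_⟩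
  have hrec' : x * besselEntire (ν + 2) x =
    besselEntire ν x - (ν + 1) * besselEntire (ν + 1) x := by linarith
  simp only [besselLogDeriv, id, Pi.mul_apply]
  field_simp
  linear_combination 4 * x * besselEntire ν x * hrec'

lemma besselLogDeriv_pos {ν x : ℝ} (hν : 0 < ν) (hx : 0 ≤ x) : 0 < besselLogDeriv ν x := by
  have h0 := besselEntire_pos hν.le hx
  have h1 := besselEntire_pos (by linarith : 0 ≤ ν + 1) hx
  unfold besselLogDeriv
  positivity

lemma besselLogDeriv_lower_bound {ν x : ℝ} (hν : 13 / 10 ≤ ν) (hx : 0 ≤ x) :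
    4 * x + ν ^ 2 < 2 * besselLogDeriv ν x ^ 2 - besselLogDeriv ν x := by
  have hν0 : 0 < ν := by linarith
  choose! d hd hric using fun (y : ℝ) (hy : 0 ≤ y) => hasDerivAt_besselLogDeriv hν0.le hy
  set h := besselLogDeriv ν
  let g (y : ℝ) : ℝ := 4 * y + ν ^ 2 - (2 * h y ^ 2 - h y)
  let g' (y : ℝ) : ℝ := 4 - (4 * h y - 1) * d y
  have hg (y : ℝ) (hy : 0 ≤ y) : HasDerivAt g (g' y) y := by
    have h1 := (((hasDerivAt_id y).const_mul 4).add_const (ν ^ 2)).sub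
      ((((hd y hy).pow 2).const_mul 2).sub (hd y hy))
    refine h1.congr_deriv ?_
    simp only [g']
    norm_num
    ring
  have hg0 : g 0 < 0 := by
    simp only [g, h, besselLogDeriv]
    norm_num
    nlinarith
  have hcross (y : ℝ) (hy : 0 ≤ y) (hgy : g y = 0) : g' y < 0 := by
    have hy0 : 0 < y := hy.lt_of_ne fun e => by rw [← e] at hgy; linarith
    have hpos : 0 < h y := besselLogDeriv_pos hν0 hy
    have hr := hric y hy
    have hgy' : 4 * y = 2 * h y ^ 2 - h y - ν ^ 2 := by simp only [g] at hgy; linarith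
    have hcubic : 0 < 4 * h y ^ 3 - 9 * h y ^ 2 + 3 * h y + 2 * ν ^ 2 := by
      nlinarith [mul_nonneg (sq_nonneg (h y - 131 / 100)) (by linarith : 0 ≤ h y + 37 / 100)]
    have heq : 2 * y * g' y = -(4 * h y ^ 3 - 9 * h y ^ 2 + 3 * h y + 2 * ν ^ 2) := by
      simp only [g']
      linear_combination (-(4 * h y - 1)) * hr + (3 - 4 * h y) * hgy'
    by_contra! hneg
    nlinarith [mul_nonneg hy hneg]
  have hle (y : ℝ) (hy : 0 ≤ y) : g y ≤ 0 :=
    image_le_of_deriv_right_lt_deriv_boundary (B := fun _ => 0) (B' := fun _ => 0)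
      (fun z hz => (hg z hz.1).continuousAt.continuousWithinAt)
      (fun z hz => (hg z hz.1).hasDerivWithinAt) hg0.le (fun z => hasDerivAt_const z 0)
      (fun z hz => hcross z hz.1) (right_mem_Icc.2 hy)
  have hlt : g x < 0 := by
    refine (hle x hx).lt_of_ne fun hgx => (hcross x hx hgx).ne ?_
    have hx0 : 0 < x := hx.lt_of_ne fun e => by rw [← e] at hgx; linarith
    refine IsLocalMax.hasDerivAt_eq_zero (f := g) ?_ (hg x hx)
    filter_upwards [Ioi_mem_nhds hx0] with z hz
    rw [hgx]
    exact hle z (le_of_lt hz)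
  simp only [g] at hlt
  linarith

theorem besselI_sq_mul_deriv_div_sq_strictAnti (ν₀ ν : ℝ) (hν₀pos : 0 < ν₀)
    (hν₀ : 8 * ν₀ ^ 3 - 9 * ν₀ ^ 2 - 2 * ν₀ - 1 = 0) (hν : ν₀ ≤ ν) :
    StrictAntiOn (fun u : ℝ => u ^ 2 * deriv (besselI ν) u / (besselI ν u) ^ 2) (Ioi 0) := by
  have hν' : 13 / 10 ≤ ν := by
    refine le_trans ?_ hν
    by_contra! hlt
    nlinarith [mul_pos hν₀pos hν₀pos, mul_pos hν₀pos (sub_pos.2 hlt),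
      mul_pos (mul_pos hν₀pos hν₀pos) (sub_pos.2 hlt)]
  have hν0 : 0 ≤ ν := by linarith
  have hI {u : ℝ} (hu : 0 < u) : 0 < besselI ν u := by
    rw [besselI_eq_rpow_mul_besselEntire ν hu]
    have := besselEntire_pos hν0 (by positivity : 0 ≤ u ^ 2 / 4)
    positivity
  have hcongr : EqOn (fun u : ℝ => u * besselLogDeriv ν (u ^ 2 / 4) / besselI ν u)
      (fun u : ℝ => u ^ 2 * deriv (besselI ν) u / (besselI ν u) ^ 2) (Ioi 0) := by
    intro u hu
    have hu : 0 < u := hu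
    have := hI hu
    simp only [(hasDerivAt_besselI hν0 hu).deriv]
    field_simp
  refine StrictAntiOn.congr ?_ hcongr
  have hderiv (u : ℝ) (hu : 0 < u) : ∃ e < 0,
      HasDerivAt (fun u : ℝ => u * besselLogDeriv ν (u ^ 2 / 4) / besselI ν u) e u := by
    have hx : 0 ≤ u ^ 2 / 4 := by positivity
    obtain ⟨d, hd, hric⟩ := hasDerivAt_besselLogDeriv hν0 hx
    have hbound := besselLogDeriv_lower_bound hν' hx
    have h2 := hasDerivAt_sq_div_four u
    have h3 := ((hasDerivAt_id u).mul (hd.comp u h2)).div (hasDerivAt_besselI hν0 hu) (hI hu).ne'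
    refine ⟨_, ?_, h3⟩
    have hIu := hI hu
    simp only [id, Pi.mul_apply, Function.comp_apply]
    set h := besselLogDeriv ν (u ^ 2 / 4)
    have hnum : (1 * h + u * (d * (u / 2))) * besselI ν u - u * h * (besselI ν u * h / u) =
        besselI ν u * (h + u ^ 2 + ν ^ 2 - 2 * h ^ 2) := by
      field_simp
      linear_combination 2 * hric
    rw [hnum]
    exact div_neg_of_neg_of_pos (mul_neg_of_pos_of_neg hIu (by linarith)) (by positivity)
  refine strictAntiOn_of_deriv_neg (convex_Ioi 0) (fun u hu => ?_) fun u hu => ?_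
  · obtain ⟨e, -, he⟩ := hderiv u hu
    exact he.continuousAt.continuousWithinAt
  · rw [interior_Ioi] at hu
    obtain ⟨e, he0, he⟩ := hderiv u hu
    rwa [he.deriv]
end

section
/- Let p ≤ 0 and q ≥ 1 be real numbers, and let ν > 1 satisfy 4(1-q)p²ν² + 4(q-2)p²ν + p²(p²+4) ≤ 0. Then the function u ↦ u^{1-p}·K_ν'(u)·K_ν(u)^{q-1} is strictly increasing on (0, ∞); equivalently, K_ν is strictly (p,q)-convex on (0, ∞). -/
open Real MeasureTheory Set

/-- The modified Bessel function of the second kind of order `ν`. -/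
noncomputable def besselK (ν u : ℝ) : ℝ :=
  ∫ t in Ioi (0 : ℝ), Real.exp (-u * Real.cosh t) * Real.cosh (ν * t)

/-- Continuous functions of at most exponential growth on `[0, ∞)`. -/
def ExpGrowth (g : ℝ → ℝ) : Prop :=
  Continuous g ∧ ∃ A k : ℝ, ∀ t : ℝ, 0 ≤ t → |g t| ≤ A * Real.exp (k * t)

namespace ExpGrowth

lemma const (c : ℝ) : ExpGrowth fun _ => c :=
  ⟨continuous_const, |c|, 0, fun t _ => by simp⟩

lemma mul {f g : ℝ → ℝ} (hf : ExpGrowth f) (hg : ExpGrowth g) :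
    ExpGrowth fun t => f t * g t := by
  obtain ⟨hfc, A, k, hA⟩ := hf
  obtain ⟨hgc, B, l, hB⟩ := hg
  refine ⟨hfc.mul hgc, A * B, k + l, fun t ht => ?_⟩
  rw [abs_mul, add_mul, Real.exp_add]
  calc |f t| * |g t| ≤ (A * Real.exp (k * t)) * (B * Real.exp (l * t)) :=
        mul_le_mul (hA t ht) (hB t ht) (abs_nonneg _) ((abs_nonneg _).trans (hA t ht))
    _ = _ := by ring

lemma add {f g : ℝ → ℝ} (hf : ExpGrowth f) (hg : ExpGrowth g) :
    ExpGrowth fun t => f t + g t := by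
  obtain ⟨hfc, A, k, hA⟩ := hf
  obtain ⟨hgc, B, l, hB⟩ := hg
  have hA0 : 0 ≤ A := by simpa using (abs_nonneg _).trans (hA 0 le_rfl)
  have hB0 : 0 ≤ B := by simpa using (abs_nonneg _).trans (hB 0 le_rfl)
  refine ⟨hfc.add hgc, A + B, max k l, fun t ht => ?_⟩
  have h₁ : A * Real.exp (k * t) ≤ A * Real.exp (max k l * t) := by
    gcongr
    exact le_max_left k l
  have h₂ : B * Real.exp (l * t) ≤ B * Real.exp (max k l * t) := by
    gcongr
    exact le_max_right k l
  linarith [abs_add_le (f t) (g t), hA t ht, hB t ht]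

lemma neg {f : ℝ → ℝ} (hf : ExpGrowth f) : ExpGrowth fun t => -f t := by
  simpa using (const (-1)).mul hf

lemma sub {f g : ℝ → ℝ} (hf : ExpGrowth f) (hg : ExpGrowth g) :
    ExpGrowth fun t => f t - g t := by
  simpa [sub_eq_add_neg] using hf.add hg.neg

lemma pow {f : ℝ → ℝ} (hf : ExpGrowth f) (n : ℕ) : ExpGrowth fun t => f t ^ n := by
  induction n with
  | zero => simpa using const 1
  | succ n ih => simpa only [pow_succ] using ih.mul hf

lemma exp_mul (a : ℝ) : ExpGrowth fun t => Real.exp (a * t) :=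
  ⟨by fun_prop, 1, a, fun t _ => by simp⟩

lemma cosh_mul (a : ℝ) : ExpGrowth fun t => Real.cosh (a * t) := by
  convert (const (1 / 2)).mul ((exp_mul a).add (exp_mul (-a))) using 2 with t
  rw [Real.cosh_eq, neg_mul]
  ring

lemma sinh_mul (a : ℝ) : ExpGrowth fun t => Real.sinh (a * t) := by
  convert (const (1 / 2)).mul ((exp_mul a).sub (exp_mul (-a))) using 2 with t
  rw [Real.sinh_eq, neg_mul]
  ring

lemma cosh : ExpGrowth Real.cosh := by simpa using cosh_mul 1

lemma sinh : ExpGrowth Real.sinh := by simpa using sinh_mul 1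

end ExpGrowth

lemma sq_div_four_le_cosh {t : ℝ} (ht : 0 ≤ t) : t ^ 2 / 4 ≤ Real.cosh t := by
  rw [Real.cosh_eq]
  linarith [Real.quadratic_le_exp_of_nonneg ht, Real.exp_pos (-t)]

lemma exp_neg_mul_cosh_mul_exp_le {u t : ℝ} (hu : 0 < u) (ht : 0 ≤ t) (k : ℝ) :
    Real.exp (-u * Real.cosh t) * Real.exp (k * t) ≤
      Real.exp ((k + 1) ^ 2 / u) * Real.exp (-t) := by
  rw [← Real.exp_add, ← Real.exp_add, Real.exp_le_exp]
  have h₁ : u * (t ^ 2 / 4) ≤ u * Real.cosh t :=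
    mul_le_mul_of_nonneg_left (sq_div_four_le_cosh ht) hu.le
  have h₂ : 0 ≤ (u * t / 2 - (k + 1)) ^ 2 / u := by positivity
  have h₃ : (u * t / 2 - (k + 1)) ^ 2 / u =
      u * (t ^ 2 / 4) - (k + 1) * t + (k + 1) ^ 2 / u := by
    field_simp
    ring
  linarith

lemma ExpGrowth.exists_exp_neg_bound {g : ℝ → ℝ} (hg : ExpGrowth g) {u : ℝ} (hu : 0 < u) :
    ∃ C : ℝ, ∀ t : ℝ, 0 ≤ t → |Real.exp (-u * Real.cosh t) * g t| ≤ C * Real.exp (-t) := by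
  obtain ⟨_, A, k, hA⟩ := hg
  have hA0 : 0 ≤ A := by simpa using (abs_nonneg _).trans (hA 0 le_rfl)
  refine ⟨A * Real.exp ((k + 1) ^ 2 / u), fun t ht => ?_⟩
  rw [abs_mul, abs_of_pos (Real.exp_pos _)]
  calc Real.exp (-u * Real.cosh t) * |g t|
      ≤ Real.exp (-u * Real.cosh t) * (A * Real.exp (k * t)) := by
        gcongr
        exact hA t ht
    _ = A * (Real.exp (-u * Real.cosh t) * Real.exp (k * t)) := by ring
    _ ≤ A * (Real.exp ((k + 1) ^ 2 / u) * Real.exp (-t)) := by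
        exact mul_le_mul_of_nonneg_left (exp_neg_mul_cosh_mul_exp_le hu ht k) hA0
    _ = _ := by ring

lemma ExpGrowth.continuous_kernel_mul {g : ℝ → ℝ} (hg : ExpGrowth g) (u : ℝ) :
    Continuous fun t => Real.exp (-u * Real.cosh t) * g t := by
  have := hg.1
  fun_prop

lemma ExpGrowth.integrableOn {g : ℝ → ℝ} (hg : ExpGrowth g) {u : ℝ} (hu : 0 < u) :
    IntegrableOn (fun t => Real.exp (-u * Real.cosh t) * g t) (Ioi 0) := by
  obtain ⟨C, hC⟩ := hg.exists_exp_neg_bound hu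
  refine ((integrableOn_exp_neg_Ioi 0).const_mul C).mono'
    (hg.continuous_kernel_mul u).aestronglyMeasurable ?_
  filter_upwards [ae_restrict_mem measurableSet_Ioi] with t ht
  exact hC t (le_of_lt ht)

lemma ExpGrowth.tendsto_zero {g : ℝ → ℝ} (hg : ExpGrowth g) {u : ℝ} (hu : 0 < u) :
    Filter.Tendsto (fun t => Real.exp (-u * Real.cosh t) * g t) Filter.atTop (nhds 0) := by
  obtain ⟨C, hC⟩ := hg.exists_exp_neg_bound hu
  refine squeeze_zero_norm' (a := fun t => C * Real.exp (-t)) ?_ ?_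
  · filter_upwards [Filter.eventually_ge_atTop 0] with t ht using hC t ht
  · simpa using (Real.tendsto_exp_neg_atTop_nhds_zero).const_mul C

lemma ExpGrowth.integral_pos {g : ℝ → ℝ} (hg : ExpGrowth g) {u : ℝ} (hu : 0 < u)
    (hpos : ∀ t, 0 < t → 0 < g t) :
    0 < ∫ t in Ioi (0 : ℝ), Real.exp (-u * Real.cosh t) * g t := by
  have h : ∀ t ∈ Ioi (0 : ℝ), 0 < Real.exp (-u * Real.cosh t) * g t :=
    fun t ht => mul_pos (Real.exp_pos _) (hpos t ht)
  rw [setIntegral_pos_iff_support_of_nonneg_ae _ (hg.integrableOn hu)]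
  · have hsub : Ioi (0 : ℝ) ⊆ Function.support fun t => Real.exp (-u * Real.cosh t) * g t :=
      fun t ht => (h t ht).ne'
    rw [inter_eq_right.2 hsub]
    simp
  · filter_upwards [ae_restrict_mem measurableSet_Ioi] with t ht using (h t ht).le

/-- Integration by parts against the kernel `exp (-u cosh t)`. -/
lemma ExpGrowth.integral_deriv_eq_zero {g g' : ℝ → ℝ} (hg : ExpGrowth g) (hg' : ExpGrowth g')
    (hd : ∀ t, HasDerivAt g (g' t) t) (h0 : g 0 = 0) {u : ℝ} (hu : 0 < u) :
    ∫ t in Ioi (0 : ℝ), Real.exp (-u * Real.cosh t) * (g' t - u * Real.sinh t * g t) = 0 := by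
  have hG : ExpGrowth fun t => g' t - u * Real.sinh t * g t :=
    hg'.sub (((ExpGrowth.const u).mul ExpGrowth.sinh).mul hg)
  rw [integral_Ioi_of_hasDerivAt_of_tendsto' (fun t _ => ?_) (hG.integrableOn hu)
    (hg.tendsto_zero hu)]
  · simp [h0]
  · have h := (((Real.hasDerivAt_cosh t).const_mul (-u)).exp).mul (hd t)
    refine h.congr_deriv ?_
    ring

/-- The moments `∫ exp (-u cosh t) (cosh t)ⁿ cosh (ν t) dt` over `(0, ∞)`. -/
noncomputable def besselMoment (ν : ℝ) (n : ℕ) (u : ℝ) : ℝ :=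
  ∫ t in Ioi (0 : ℝ), Real.exp (-u * Real.cosh t) * (Real.cosh t ^ n * Real.cosh (ν * t))

lemma expGrowth_moment (ν : ℝ) (n : ℕ) :
    ExpGrowth fun t => Real.cosh t ^ n * Real.cosh (ν * t) :=
  (ExpGrowth.cosh.pow n).mul (ExpGrowth.cosh_mul ν)

lemma besselK_eq_moment (ν : ℝ) : besselK ν = besselMoment ν 0 := by
  funext u
  simp [besselK, besselMoment]

lemma besselMoment_pos (ν : ℝ) (n : ℕ) {u : ℝ} (hu : 0 < u) : 0 < besselMoment ν n u :=
  (expGrowth_moment ν n).integral_pos hu fun t _ =>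
    mul_pos (pow_pos (Real.cosh_pos t) n) (Real.cosh_pos _)

lemma hasDerivAt_besselMoment (ν : ℝ) (n : ℕ) {u : ℝ} (hu : 0 < u) :
    HasDerivAt (besselMoment ν n) (-besselMoment ν (n + 1) u) u := by
  have hu2 : 0 < u / 2 := by positivity
  have key := (hasDerivAt_integral_of_dominated_loc_of_deriv_le (μ := volume.restrict (Ioi (0 : ℝ)))
    (F := fun u t => Real.exp (-u * Real.cosh t) * (Real.cosh t ^ n * Real.cosh (ν * t)))
    (F' := fun u t => -(Real.exp (-u * Real.cosh t) *
      (Real.cosh t ^ (n + 1) * Real.cosh (ν * t))))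
    (bound := fun t => Real.exp (-(u / 2) * Real.cosh t) *
      (Real.cosh t ^ (n + 1) * Real.cosh (ν * t)))
    (x₀ := u) (s := Ioi (u / 2)) (Ioi_mem_nhds (by linarith))
    (Filter.Eventually.of_forall fun v =>
      ((expGrowth_moment ν n).continuous_kernel_mul v).aestronglyMeasurable)
    ((expGrowth_moment ν n).integrableOn hu)
    ((expGrowth_moment ν (n + 1)).continuous_kernel_mul u).neg.aestronglyMeasurable
    (Filter.Eventually.of_forall fun t v hv => ?_)
    ((expGrowth_moment ν (n + 1)).integrableOn hu2)
    (Filter.Eventually.of_forall fun t v _ => ?_)).2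
  · rw [integral_neg] at key
    exact key
  · have hc := Real.cosh_pos t
    have hc' := Real.cosh_pos (ν * t)
    rw [norm_neg, Real.norm_of_nonneg (by positivity)]
    gcongr
    exact le_of_lt hv
  · have h := ((((hasDerivAt_id v).neg.mul_const (Real.cosh t)).exp).mul_const
      (Real.cosh t ^ n * Real.cosh (ν * t)))
    refine h.congr_deriv ?_
    simp only [id, Pi.neg_apply]
    ring

lemma hasDerivAt_cosh_mul (a t : ℝ) :
    HasDerivAt (fun t => Real.cosh (a * t)) (a * Real.sinh (a * t)) t := by
  refine ((hasDerivAt_id t).const_mul a).cosh.congr_deriv ?_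
  simp only [id]
  ring

lemma hasDerivAt_sinh_mul (a t : ℝ) :
    HasDerivAt (fun t => Real.sinh (a * t)) (a * Real.cosh (a * t)) t := by
  refine ((hasDerivAt_id t).const_mul a).sinh.congr_deriv ?_
  simp only [id]
  ring

/-- The modified Bessel differential equation in terms of the moments. -/
lemma besselMoment_ode (ν : ℝ) {u : ℝ} (hu : 0 < u) :
    u ^ 2 * besselMoment ν 2 u =
      u * besselMoment ν 1 u + (u ^ 2 + ν ^ 2) * besselMoment ν 0 u := by
  have hS := ExpGrowth.sinh_mul ν
  have hC := ExpGrowth.cosh_mul ν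
  have hs := ExpGrowth.sinh
  have hc := ExpGrowth.cosh
  have h := ExpGrowth.integral_deriv_eq_zero
    (g := fun t => u * (Real.sinh t * Real.cosh (ν * t)) + ν * Real.sinh (ν * t))
    (g' := fun t => u * (Real.cosh t * Real.cosh (ν * t) +
      Real.sinh t * (ν * Real.sinh (ν * t))) + ν * (ν * Real.cosh (ν * t)))
    (((ExpGrowth.const u).mul (hs.mul hC)).add ((ExpGrowth.const ν).mul hS))
    (((ExpGrowth.const u).mul ((hc.mul hC).add (hs.mul ((ExpGrowth.const ν).mul hS)))).add
      ((ExpGrowth.const ν).mul ((ExpGrowth.const ν).mul hC)))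
    (fun t => ((((Real.hasDerivAt_sinh t).mul (hasDerivAt_cosh_mul ν t)).const_mul u).add
      ((hasDerivAt_sinh_mul ν t).const_mul ν))) (by simp) hu
  have i0 := ((expGrowth_moment ν 0).integrableOn hu).const_mul (u ^ 2 + ν ^ 2)
  have i1 := ((expGrowth_moment ν 1).integrableOn hu).const_mul u
  have i2 := ((expGrowth_moment ν 2).integrableOn hu).const_mul (u ^ 2)
  have e : ∀ t : ℝ, Real.exp (-u * Real.cosh t) *
      (u * (Real.cosh t * Real.cosh (ν * t) + Real.sinh t * (ν * Real.sinh (ν * t))) +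
        ν * (ν * Real.cosh (ν * t)) - u * Real.sinh t *
        (u * (Real.sinh t * Real.cosh (ν * t)) + ν * Real.sinh (ν * t))) =
      u * (Real.exp (-u * Real.cosh t) * (Real.cosh t ^ 1 * Real.cosh (ν * t))) +
      (u ^ 2 + ν ^ 2) * (Real.exp (-u * Real.cosh t) * (Real.cosh t ^ 0 * Real.cosh (ν * t))) -
      u ^ 2 * (Real.exp (-u * Real.cosh t) * (Real.cosh t ^ 2 * Real.cosh (ν * t))) := by
    intro t
    rw [Real.cosh_sq t]
    ring
  simp_rw [e] at h
  rw [integral_sub (by exact i1.add i0) i2, integral_add i1 i0, integral_const_mul, integral_const_mul,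
    integral_const_mul] at h
  simp only [besselMoment]
  linarith

/-- The recurrence `-u K_ν' = ν K_ν + u K_{ν-1}` in terms of the moments. -/
lemma besselMoment_recurrence (ν : ℝ) {u : ℝ} (hu : 0 < u) :
    u * besselMoment ν 1 u = ν * besselMoment ν 0 u + u * besselMoment (ν - 1) 0 u := by
  have hS := ExpGrowth.sinh_mul ν
  have hC := ExpGrowth.cosh_mul ν
  have h := ExpGrowth.integral_deriv_eq_zero (g := fun t => Real.sinh (ν * t))
    (g' := fun t => ν * Real.cosh (ν * t)) hS ((ExpGrowth.const ν).mul hC)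
    (hasDerivAt_sinh_mul ν) (by simp) hu
  have i0 := ((expGrowth_moment ν 0).integrableOn hu).const_mul ν
  have i1 := ((expGrowth_moment ν 1).integrableOn hu).const_mul u
  have i2 := ((expGrowth_moment (ν - 1) 0).integrableOn hu).const_mul u
  have e : ∀ t : ℝ, Real.exp (-u * Real.cosh t) *
      (ν * Real.cosh (ν * t) - u * Real.sinh t * Real.sinh (ν * t)) =
      ν * (Real.exp (-u * Real.cosh t) * (Real.cosh t ^ 0 * Real.cosh (ν * t))) +
      u * (Real.exp (-u * Real.cosh t) * (Real.cosh t ^ 0 * Real.cosh ((ν - 1) * t))) -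
      u * (Real.exp (-u * Real.cosh t) * (Real.cosh t ^ 1 * Real.cosh (ν * t))) := by
    intro t
    rw [sub_one_mul, Real.cosh_sub]
    ring
  simp_rw [e] at h
  rw [integral_sub (by exact i0.add i2) i1, integral_add i0 i2, integral_const_mul, integral_const_mul,
    integral_const_mul] at h
  simp only [besselMoment]
  linarith

lemma besselMoment_sub_one_le {ν : ℝ} (hν : 1 < ν) {u : ℝ} (hu : 0 < u) :
    besselMoment (ν - 1) 0 u ≤ besselMoment ν 0 u := by
  refine setIntegral_mono_on ((expGrowth_moment _ 0).integrableOn hu)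
    ((expGrowth_moment _ 0).integrableOn hu) measurableSet_Ioi fun t ht => ?_
  have ht' : 0 < t := ht
  gcongr
  rw [Real.cosh_le_cosh, abs_of_nonneg (by nlinarith), abs_of_nonneg (by nlinarith)]
  nlinarith

/-- The ratio `-u K_ν'(u) / K_ν(u)`. -/
noncomputable def besselRatio (ν u : ℝ) : ℝ := u * besselMoment ν 1 u / besselMoment ν 0 u

lemma lt_besselRatio (ν : ℝ) {u : ℝ} (hu : 0 < u) : ν < besselRatio ν u := by
  rw [besselRatio, lt_div_iff₀ (besselMoment_pos ν 0 hu), besselMoment_recurrence ν hu]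
  linarith [mul_pos hu (besselMoment_pos (ν - 1) 0 hu)]

lemma besselRatio_le {ν : ℝ} (hν : 1 < ν) {u : ℝ} (hu : 0 < u) : besselRatio ν u ≤ ν + u := by
  rw [besselRatio, div_le_iff₀ (besselMoment_pos ν 0 hu), besselMoment_recurrence ν hu]
  linarith [mul_le_mul_of_nonneg_left (besselMoment_sub_one_le hν hu) hu.le]

/-- The Riccati equation satisfied by `-u K_ν'(u) / K_ν(u)`. -/
lemma hasDerivAt_besselRatio (ν : ℝ) {u : ℝ} (hu : 0 < u) :
    HasDerivAt (besselRatio ν) ((besselRatio ν u ^ 2 - u ^ 2 - ν ^ 2) / u) u := by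
  have h0 := (besselMoment_pos ν 0 hu).ne'
  have h := ((hasDerivAt_id u).mul (hasDerivAt_besselMoment ν 1 hu)).div
    (hasDerivAt_besselMoment ν 0 hu) h0
  refine h.congr_deriv ?_
  simp only [besselRatio, id, Pi.mul_apply, zero_add, Nat.reduceAdd]
  field_simp
  linear_combination (-besselMoment ν 0 u) * besselMoment_ode ν hu

lemma sq_besselRatio_lt {ν : ℝ} (hν : 1 < ν) {u : ℝ} (hu : 0 < u) :
    besselRatio ν u ^ 2 < ν / (ν - 1) * u ^ 2 + ν ^ 2 := by
  by_contra! hcon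
  have hν1 : 0 < ν - 1 := by linarith
  set T : ℝ := u + 2 * ν * (ν - 1) with hT
  have huT : u ≤ T := by rw [hT]; nlinarith
  have hder : ∀ x, 0 < x → HasDerivAt
      (fun x => ν / (ν - 1) * x ^ 2 + ν ^ 2 - besselRatio ν x ^ 2)
      (ν / (ν - 1) * (2 * x) -
        2 * besselRatio ν x * ((besselRatio ν x ^ 2 - x ^ 2 - ν ^ 2) / x)) x := by
    intro x hx
    refine ((((hasDerivAt_pow 2 x).const_mul (ν / (ν - 1))).add_const (ν ^ 2)).sub
      ((hasDerivAt_besselRatio ν hx).pow 2)).congr_deriv ?_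
    simp
  have hle := image_le_of_deriv_right_lt_deriv_boundary (a := u) (b := T)
    (B := fun _ => 0) (B' := fun _ => 0)
    (fun x hx => (hder x (hu.trans_le hx.1)).continuousAt.continuousWithinAt)
    (fun x hx => (hder x (hu.trans_le hx.1)).hasDerivWithinAt)
    (by linarith) (fun x => hasDerivAt_const x 0)
    (fun x hx hx0 => ?_) (right_mem_Icc.2 huT)
  · have hT0 : 0 < T := hu.trans_le huT
    have h₁ := besselRatio_le hν hT0
    have h₂ := lt_besselRatio ν hT0
    have h₃ : besselRatio ν T ^ 2 ≤ (ν + T) ^ 2 := by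
      apply pow_le_pow_left₀ <;> linarith
    have h₄ : ν / (ν - 1) * T ^ 2 = T ^ 2 + T * (T / (ν - 1)) := by
      field_simp
      ring
    have h₅ : 2 * ν < T / (ν - 1) := by
      rw [lt_div_iff₀ hν1, hT]
      linarith
    nlinarith [mul_lt_mul_of_pos_left h₅ hT0]
  · have hx' : 0 < x := hu.trans_le hx.1
    have hy := lt_besselRatio ν hx'
    have hsq : besselRatio ν x ^ 2 - x ^ 2 - ν ^ 2 = x ^ 2 / (ν - 1) := by
      have : ν / (ν - 1) * x ^ 2 = x ^ 2 + x ^ 2 / (ν - 1) := by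
        field_simp
        ring
      linarith
    rw [hsq]
    have : ν / (ν - 1) * (2 * x) - 2 * besselRatio ν x * (x ^ 2 / (ν - 1) / x) =
        2 * x / (ν - 1) * (ν - besselRatio ν x) := by
      field_simp
    rw [this]
    exact mul_neg_of_pos_of_neg (by positivity) (by linarith)

lemma quadratic_nonneg_of_besselCond {p q ν y : ℝ} (hp : p ≤ 0) (hq : 1 ≤ q) (hν : 1 < ν)
    (hcond : 4 * (1 - q) * p ^ 2 * ν ^ 2 + 4 * (q - 2) * p ^ 2 * ν + p ^ 2 * (p ^ 2 + 4) ≤ 0)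
    (hy : ν < y) : 0 ≤ (q * ν - 1) * y ^ 2 + p * ν * y + ν ^ 2 := by
  have hqν : ν ≤ q * ν := by nlinarith
  rcases hp.eq_or_lt with rfl | hp
  · have : 0 ≤ (q * ν - 1) * y ^ 2 := mul_nonneg (by linarith) (sq_nonneg y)
    nlinarith
  have hp2 : p ^ 2 ≤ 4 * (ν - 1) * ((q - 1) * ν + 1) := by
    have : 0 < p ^ 2 := sq_pos_of_neg hp
    by_contra! h
    nlinarith [mul_pos this (sub_pos.2 h)]
  rcases le_total ν 2 with h2 | h2
  · have hdisc : p ^ 2 ≤ 4 * (q * ν - 1) := by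
      nlinarith [mul_nonneg (mul_nonneg (sub_nonneg.2 hq) (by linarith : 0 ≤ ν)) (sub_nonneg.2 h2)]
    have hpos : 0 < q * ν - 1 := by linarith
    have : 0 ≤ 4 * (q * ν - 1) * ((q * ν - 1) * y ^ 2 + p * ν * y + ν ^ 2) := by
      nlinarith [sq_nonneg (2 * (q * ν - 1) * y + p * ν),
        mul_nonneg (sub_nonneg.2 hdisc) (sq_nonneg ν)]
    exact nonneg_of_mul_nonneg_right this (by linarith)
  · have hpq : -p ≤ q * ν := by
      apply abs_le_of_sq_le_sq' _ (by linarith) |>.2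
      nlinarith [sq_nonneg (ν - 1 - ((q - 1) * ν + 1))]
    -- The quadratic is nonnegative at `ν` and nondecreasing on `[ν, ∞)`.
    have h₁ : 0 ≤ (q * ν - 1) * (y + ν) + p * ν := by
      nlinarith
    have h₂ : 0 ≤ ν ^ 2 * (q * ν + p) := mul_nonneg (sq_nonneg ν) (by linarith)
    nlinarith [mul_nonneg (sub_nonneg.2 hy.le) h₁]

lemma besselRatio_quadratic_pos {p q ν : ℝ} (hp : p ≤ 0) (hq : 1 ≤ q) (hν : 1 < ν)
    (hcond : 4 * (1 - q) * p ^ 2 * ν ^ 2 + 4 * (q - 2) * p ^ 2 * ν + p ^ 2 * (p ^ 2 + 4) ≤ 0)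
    {u : ℝ} (hu : 0 < u) :
    0 < (q - 1) * besselRatio ν u ^ 2 + p * besselRatio ν u + u ^ 2 + ν ^ 2 := by
  have h₁ := quadratic_nonneg_of_besselCond hp hq hν hcond (lt_besselRatio ν hu)
  have h₂ := sq_besselRatio_lt hν hu
  have hν1 : 0 < ν - 1 := by linarith
  have h₃ : (ν - 1) * besselRatio ν u ^ 2 < ν * u ^ 2 + (ν - 1) * ν ^ 2 := by
    have h := mul_lt_mul_of_pos_left h₂ hν1
    have e : (ν - 1) * (ν / (ν - 1) * u ^ 2 + ν ^ 2) = ν * u ^ 2 + (ν - 1) * ν ^ 2 := by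
      field_simp
    linarith
  refine pos_of_mul_pos_right (a := ν) ?_ (by linarith)
  nlinarith

theorem besselK_pq_convex (p q ν : ℝ) (hp : p ≤ 0) (hq : 1 ≤ q) (hν : 1 < ν)
    (hcond : 4 * (1 - q) * p ^ 2 * ν ^ 2 + 4 * (q - 2) * p ^ 2 * ν + p ^ 2 * (p ^ 2 + 4) ≤ 0) :
    StrictMonoOn (fun u : ℝ => u ^ (1 - p) * deriv (besselK ν) u * (besselK ν u) ^ (q - 1))
      (Ioi 0) := by
  rw [besselK_eq_moment]
  have hder : ∀ u : ℝ, 0 < u → HasDerivAt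
      (fun u : ℝ => u ^ (1 - p) * -besselMoment ν 1 u * besselMoment ν 0 u ^ (q - 1))
      (u ^ (-p - 1) * besselMoment ν 0 u ^ q *
        ((q - 1) * besselRatio ν u ^ 2 + p * besselRatio ν u + u ^ 2 + ν ^ 2)) u := by
    intro u hu
    have h0 := besselMoment_pos ν 0 hu
    have h := (((hasDerivAt_id u).rpow_const (p := 1 - p) (Or.inl hu.ne')).mul
      (hasDerivAt_besselMoment ν 1 hu).neg).mul
      ((hasDerivAt_besselMoment ν 0 hu).rpow_const (p := q - 1) (Or.inl h0.ne'))
    refine h.congr_deriv ?_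
    have e₁ : u ^ (1 - p) = u ^ (-p - 1) * u ^ 2 := by
      rw [← Real.rpow_natCast, ← Real.rpow_add hu]
      norm_num
      ring_nf
    have e₂ : u ^ (1 - p - 1) = u ^ (-p - 1) * u := by
      rw [← Real.rpow_add_one hu.ne']
      ring_nf
    have e₃ : besselMoment ν 0 u ^ q = besselMoment ν 0 u ^ (q - 1 - 1) *
        besselMoment ν 0 u ^ 2 := by
      rw [← Real.rpow_natCast, ← Real.rpow_add h0]
      norm_num
      ring_nf
    have e₄ : besselMoment ν 0 u ^ (q - 1) = besselMoment ν 0 u ^ (q - 1 - 1) *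
        besselMoment ν 0 u := by
      rw [← Real.rpow_add_one h0.ne']
      ring_nf
    simp only [id, Pi.neg_apply, Pi.mul_apply, besselRatio, zero_add, Nat.reduceAdd]
    rw [e₁, e₂, e₃, e₄]
    field_simp
    linear_combination besselMoment ν 0 u * besselMoment_ode ν hu
  refine StrictMonoOn.congr (strictMonoOn_of_deriv_pos (convex_Ioi 0)
    (fun u hu => (hder u hu).continuousAt.continuousWithinAt) fun u hu => ?_) fun u hu => ?_
  · rw [interior_Ioi] at hu
    have hu' : 0 < u := hu
    rw [(hder u hu).deriv]
    exact mul_pos (mul_pos (Real.rpow_pos_of_pos hu' _)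
      (Real.rpow_pos_of_pos (besselMoment_pos ν 0 hu) _))
      (besselRatio_quadratic_pos hp hq hν hcond hu)
  · simp only [(hasDerivAt_besselMoment ν 0 hu).deriv, zero_add]
end

section
/- Let a, b, α > 0 and let f_{a,b,α}(u) = (2·(ab)^{(a+b)/2}·u^{(a+b)/2 - 1})/(Γ(a)·Γ(b)·α^{(a+b)/2}) · K_{a-b}(2·√(ab·u/α)) be the probability density function of the gamma-gamma distribution, and let F_{a,b,α}(u) = ∫_0^u f_{a,b,α}(t) dt be its cumulative distribution function. Then F_{a,b,α} is strictly log-concave on (0, ∞); in particular, for all λ ∈ (0,1) and all u₁ ≠ u₂ in (0,∞), F_{a,b,α}(λu₁ + (1-λ)u₂) > F_{a,b,α}(u₁)^λ · F_{a,b,α}(u₂)^{1-λ}. -/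
open Real MeasureTheory Set

/-- The probability density function of the three parameter gamma-gamma distribution. -/
noncomputable def gammaGammaPdf (a b α u : ℝ) : ℝ :=
  2 * (a * b) ^ ((a + b) / 2) * u ^ ((a + b) / 2 - 1) /
      (Real.Gamma a * Real.Gamma b * α ^ ((a + b) / 2)) *
    besselK (a - b) (2 * Real.sqrt (a * b * u / α))

/-- The cumulative distribution function of the three parameter gamma-gamma distribution. -/
noncomputable def gammaGammaCdf (a b α u : ℝ) : ℝ :=
  ∫ t in (0 : ℝ)..u, gammaGammaPdf a b α t

/-- The integrand of `(-1) ^ n` times the `n`-th derivative of `besselK ν`. -/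
noncomputable def besselKIntegrand (ν : ℝ) (n : ℕ) (u t : ℝ) : ℝ :=
  Real.exp (-u * Real.cosh t) * Real.cosh t ^ n * Real.cosh (ν * t)

/-- `(-1) ^ n` times the `n`-th derivative of `besselK ν`, as an integral. -/
noncomputable def besselKMoment (ν : ℝ) (n : ℕ) (u : ℝ) : ℝ :=
  ∫ t in Ioi (0 : ℝ), besselKIntegrand ν n u t

lemma besselKMoment_zero (ν : ℝ) : besselKMoment ν 0 = besselK ν := by
  funext u
  simp [besselKMoment, besselKIntegrand, besselK]

lemma besselKIntegrand_pos (ν : ℝ) (n : ℕ) (u t : ℝ) : 0 < besselKIntegrand ν n u t := by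
  unfold besselKIntegrand
  have := Real.cosh_pos t
  have := Real.cosh_pos (ν * t)
  positivity

lemma continuous_besselKIntegrand (ν : ℝ) (n : ℕ) (u : ℝ) :
    Continuous (besselKIntegrand ν n u) := by
  unfold besselKIntegrand
  fun_prop

lemma exp_neg_le_div_rpow {μ x : ℝ} (hμ : 0 < μ) (hx : 0 < x) :
    Real.exp (-x) ≤ (x / μ) ^ (-μ) := by
  have h : (x / μ) ^ μ ≤ Real.exp x := by
    have h1 : x / μ ≤ Real.exp (x / μ) := by linarith [Real.add_one_le_exp (x / μ)]
    calc (x / μ) ^ μ ≤ Real.exp (x / μ) ^ μ := Real.rpow_le_rpow (by positivity) h1 hμ.le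
      _ = Real.exp x := by rw [← Real.exp_mul]; congr 1; field_simp
  rw [Real.exp_neg, Real.rpow_neg (by positivity)]
  exact inv_anti₀ (by positivity) h

lemma exp_le_two_mul_cosh (t : ℝ) : Real.exp t ≤ 2 * Real.cosh t := by
  rw [Real.cosh_eq]
  linarith [Real.exp_pos (-t)]

lemma cosh_le_exp_abs (t : ℝ) : Real.cosh t ≤ Real.exp |t| := by
  rw [Real.cosh_eq]
  have h1 := Real.exp_le_exp.2 (le_abs_self t)
  have h2 := Real.exp_le_exp.2 (neg_le_abs t)
  linarith

lemma cosh_mul_le_rpow (ν : ℝ) {t : ℝ} (ht : 0 ≤ t) :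
    Real.cosh (ν * t) ≤ (2 * Real.cosh t) ^ |ν| := by
  calc Real.cosh (ν * t) ≤ Real.exp |ν * t| := cosh_le_exp_abs _
    _ = Real.exp t ^ |ν| := by rw [← Real.exp_mul, abs_mul, abs_of_nonneg ht, mul_comm]
    _ ≤ _ := Real.rpow_le_rpow (Real.exp_pos t).le (exp_le_two_mul_cosh t) (abs_nonneg ν)

lemma besselKIntegrand_le {ν μ u t : ℝ} {n : ℕ} (hμ : n + |ν| < μ) (hu : 0 < u) (ht : 0 ≤ t) :
    besselKIntegrand ν n u t ≤
      2 ^ μ * (u / μ) ^ (-μ) * Real.exp (-(μ - n - |ν|) * t) := by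
  have hμ0 : 0 < μ := lt_of_le_of_lt (by positivity) hμ
  have hx := Real.cosh_pos t
  set x := Real.cosh t with hxdef
  have h1 : Real.exp (-u * x) ≤ (u / μ) ^ (-μ) * x ^ (-μ) := by
    rw [← Real.mul_rpow (by positivity) hx.le, neg_mul]
    convert exp_neg_le_div_rpow hμ0 (mul_pos hu hx) using 2
    ring
  have h2 := cosh_mul_le_rpow ν ht
  have h3 : x ^ n ≤ (2 * x) ^ (n : ℝ) := by
    rw [Real.rpow_natCast]
    gcongr
    linarith
  have h4 : (2 * x) ^ (-(μ - n - |ν|)) ≤ Real.exp (-(μ - n - |ν|) * t) := by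
    rw [mul_comm _ t, Real.exp_mul]
    exact Real.rpow_le_rpow_of_nonpos (Real.exp_pos t) (exp_le_two_mul_cosh t)
      (by linarith : -(μ - n - |ν|) ≤ 0)
  calc besselKIntegrand ν n u t
      ≤ ((u / μ) ^ (-μ) * x ^ (-μ)) * (2 * x) ^ (n : ℝ) * (2 * x) ^ |ν| := by
        unfold besselKIntegrand
        have := Real.cosh_pos (ν * t)
        gcongr
    _ = 2 ^ μ * (u / μ) ^ (-μ) * (2 * x) ^ (-(μ - n - |ν|)) := by
        have e1 : x ^ (-μ) = 2 ^ μ * (2 * x) ^ (-μ) := by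
          rw [Real.mul_rpow (by norm_num) hx.le, ← mul_assoc, ← Real.rpow_add (by norm_num)]
          simp
        have e2 : -(μ - n - |ν|) = -μ + n + |ν| := by ring
        rw [e1, e2, Real.rpow_add (by positivity), Real.rpow_add (by positivity)]
        ring
    _ ≤ _ := by gcongr

lemma integrableOn_besselKIntegrand (ν : ℝ) (n : ℕ) {u : ℝ} (hu : 0 < u) :
    IntegrableOn (besselKIntegrand ν n u) (Ioi 0) := by
  have hμ : (n : ℝ) + |ν| < n + |ν| + 1 := by linarith
  refine Integrable.mono' (((exp_neg_integrableOn_Ioi 0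
    (by linarith : 0 < (n : ℝ) + |ν| + 1 - n - |ν|)).const_mul
      (2 ^ ((n : ℝ) + |ν| + 1) * (u / (n + |ν| + 1)) ^ (-((n : ℝ) + |ν| + 1)))))
    (continuous_besselKIntegrand ν n u).aestronglyMeasurable ?_
  filter_upwards [ae_restrict_mem measurableSet_Ioi] with t ht
  rw [Real.norm_of_nonneg (besselKIntegrand_pos ν n u t).le]
  exact besselKIntegrand_le hμ hu (mem_Ioi.1 ht).le

lemma besselKMoment_pos (ν : ℝ) (n : ℕ) {u : ℝ} (hu : 0 < u) : 0 < besselKMoment ν n u := by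
  refine (setIntegral_pos_iff_support_of_nonneg_ae
    (Filter.Eventually.of_forall fun t => (besselKIntegrand_pos ν n u t).le)
    (integrableOn_besselKIntegrand ν n hu)).2 ?_
  have : Function.support (besselKIntegrand ν n u) = univ :=
    eq_univ_of_forall fun t => (besselKIntegrand_pos ν n u t).ne'
  simp [this]

lemma exists_besselKMoment_le {ν μ : ℝ} {n : ℕ} (hμ : n + |ν| < μ) :
    ∃ C, ∀ u, 0 < u → besselKMoment ν n u ≤ C * u ^ (-μ) := by
  have hμ0 : 0 < μ := lt_of_le_of_lt (by positivity) hμ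
  have hi := exp_neg_integrableOn_Ioi 0 (by linarith : 0 < μ - n - |ν|)
  refine ⟨2 ^ μ * μ⁻¹ ^ (-μ) * ∫ t in Ioi (0 : ℝ), Real.exp (-(μ - n - |ν|) * t),
    fun u hu => ?_⟩
  calc besselKMoment ν n u
      ≤ ∫ t in Ioi (0 : ℝ), 2 ^ μ * (u / μ) ^ (-μ) * Real.exp (-(μ - n - |ν|) * t) :=
        setIntegral_mono_on (integrableOn_besselKIntegrand ν n hu) (hi.const_mul _)
          measurableSet_Ioi fun t ht => besselKIntegrand_le hμ hu (mem_Ioi.1 ht).le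
    _ = _ := by
        rw [integral_const_mul, div_eq_mul_inv, Real.mul_rpow hu.le (by positivity)]
        ring

lemma hasDerivAt_besselKMoment (ν : ℝ) (n : ℕ) {u : ℝ} (hu : 0 < u) :
    HasDerivAt (besselKMoment ν n) (-besselKMoment ν (n + 1) u) u := by
  have h := (hasDerivAt_integral_of_dominated_loc_of_deriv_le (μ := volume.restrict (Ioi 0))
    (F := besselKIntegrand ν n) (F' := fun v t => -besselKIntegrand ν (n + 1) v t)
    (x₀ := u) (s := Ioi (u / 2)) (bound := besselKIntegrand ν (n + 1) (u / 2))
    (Ioi_mem_nhds (by linarith))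
    (Filter.Eventually.of_forall fun v => (continuous_besselKIntegrand ν n v).aestronglyMeasurable)
    (integrableOn_besselKIntegrand ν n hu)
    (continuous_besselKIntegrand ν (n + 1) u).neg.aestronglyMeasurable
    (Filter.Eventually.of_forall fun t v hv => ?_)
    (integrableOn_besselKIntegrand ν (n + 1) (by positivity))
    (Filter.Eventually.of_forall fun t v hv => ?_)).2
  · rw [integral_neg] at h
    exact h
  · rw [norm_neg, Real.norm_of_nonneg (besselKIntegrand_pos ν (n + 1) v t).le]
    unfold besselKIntegrand
    have := Real.cosh_pos t
    have := Real.cosh_pos (ν * t)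
    have := (mem_Ioi.1 hv).le
    gcongr
  · unfold besselKIntegrand
    have h1 : HasDerivAt (fun v : ℝ => -v * Real.cosh t) (-1 * Real.cosh t) v :=
      (hasDerivAt_id v).neg.mul_const _
    exact ((h1.exp.mul_const (Real.cosh t ^ n)).mul_const (Real.cosh (ν * t))).congr_deriv
      (by ring)

/-- The modified Bessel differential equation. -/
lemma besselKMoment_ode (ν : ℝ) {u : ℝ} (hu : 0 < u) :
    u ^ 2 * besselKMoment ν 2 u =
      u * besselKMoment ν 1 u + (u ^ 2 + ν ^ 2) * besselKMoment ν 0 u := by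
  have hi := fun n => integrableOn_besselKIntegrand ν n hu
  have hderiv : ∀ t ∈ Ici (0 : ℝ), HasDerivAt
      (fun t => -u * Real.sinh t * Real.exp (-u * Real.cosh t) * Real.cosh (ν * t) -
        ν * (Real.exp (-u * Real.cosh t) * Real.sinh (ν * t)))
      (u ^ 2 * besselKIntegrand ν 2 u t - u * besselKIntegrand ν 1 u t -
        (u ^ 2 + ν ^ 2) * besselKIntegrand ν 0 u t) t := by
    intro t _
    have hE := ((Real.hasDerivAt_cosh t).const_mul (-u)).exp
    have hν : HasDerivAt (fun t : ℝ => ν * t) ν t := by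
      simpa using (hasDerivAt_id t).const_mul ν
    have h := ((((Real.hasDerivAt_sinh t).const_mul (-u)).mul hE).mul hν.cosh).sub
      ((hE.mul hν.sinh).const_mul ν)
    refine h.congr_deriv ?_
    have hs : Real.sinh t ^ 2 = Real.cosh t ^ 2 - 1 := by rw [Real.cosh_sq]; ring
    simp only [besselKIntegrand, Pi.mul_apply]
    linear_combination (u ^ 2 * Real.exp (-u * Real.cosh t) * Real.cosh (ν * t)) * hs
  have hlim : ∀ n : ℕ, Filter.Tendsto (besselKIntegrand ν n u) Filter.atTop (nhds 0) := by
    intro n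
    have hμ : (n : ℝ) + |ν| < n + |ν| + 1 := by linarith
    have he : Filter.Tendsto (fun t : ℝ => 2 ^ ((n : ℝ) + |ν| + 1) *
        (u / (n + |ν| + 1)) ^ (-((n : ℝ) + |ν| + 1)) *
          Real.exp (-(n + |ν| + 1 - n - |ν|) * t)) Filter.atTop (nhds 0) := by
      have : ∀ t : ℝ, -((n : ℝ) + |ν| + 1 - n - |ν|) * t = -t := fun t => by ring
      simp only [this]
      simpa using Real.tendsto_exp_neg_atTop_nhds_zero.const_mul _
    refine tendsto_of_tendsto_of_tendsto_of_le_of_le' tendsto_const_nhds he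
      (Filter.Eventually.of_forall fun t => (besselKIntegrand_pos ν n u t).le) ?_
    filter_upwards [Filter.eventually_ge_atTop 0] with t ht
    exact besselKIntegrand_le hμ hu ht
  have hsinh : ∀ x : ℝ, |Real.sinh x| ≤ Real.cosh x := fun x =>
    abs_le_of_sq_le_sq (by rw [Real.cosh_sq]; linarith) (Real.cosh_pos x).le
  have htend : Filter.Tendsto
      (fun t => -u * Real.sinh t * Real.exp (-u * Real.cosh t) * Real.cosh (ν * t) -
        ν * (Real.exp (-u * Real.cosh t) * Real.sinh (ν * t))) Filter.atTop (nhds 0) := by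
    refine squeeze_zero_norm (a := fun t => u * besselKIntegrand ν 1 u t +
      |ν| * besselKIntegrand ν 0 u t) (fun t => ?_) ?_
    · rw [Real.norm_eq_abs]
      refine (abs_sub _ _).trans ?_
      simp only [abs_mul, abs_neg, abs_of_pos hu, Real.abs_exp, abs_of_pos (Real.cosh_pos _), besselKIntegrand,
        pow_one, pow_zero, mul_one]
      have h1 := hsinh t
      have h2 := hsinh (ν * t)
      have := Real.cosh_pos (ν * t)
      calc _ ≤ u * Real.cosh t * Real.exp (-u * Real.cosh t) * Real.cosh (ν * t) +
          |ν| * (Real.exp (-u * Real.cosh t) * Real.cosh (ν * t)) := by gcongr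
        _ = _ := by ring
    · simpa using ((hlim 1).const_mul u).add ((hlim 0).const_mul |ν|)
  have hi2 := (hi 2).const_mul (u ^ 2)
  have hi1 := (hi 1).const_mul u
  have hi0 := (hi 0).const_mul (u ^ 2 + ν ^ 2)
  have hi21 : IntegrableOn (fun t => u ^ 2 * besselKIntegrand ν 2 u t -
      u * besselKIntegrand ν 1 u t) (Ioi 0) := hi2.sub hi1
  have h := integral_Ioi_of_hasDerivAt_of_tendsto' hderiv (hi21.sub hi0) htend
  rw [integral_sub hi21 hi0, integral_sub hi2 hi1, integral_const_mul,
    integral_const_mul, integral_const_mul] at h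
  simp only [Real.sinh_zero, mul_zero, zero_mul, sub_zero] at h
  simp only [besselKMoment]
  linarith
lemma sq_mul_le_sq_mul_besselKMoment (ν : ℝ) {u : ℝ} (hu : 0 < u) :
    (u ^ 2 + ν ^ 2) * besselKMoment ν 0 u ^ 2 ≤ u ^ 2 * besselKMoment ν 1 u ^ 2 := by
  set D : ℝ → ℝ := fun u => u ^ 2 * besselKMoment ν 1 u ^ 2 -
    (u ^ 2 + ν ^ 2) * besselKMoment ν 0 u ^ 2 with hD
  have hderiv : ∀ x, 0 < x → HasDerivAt D (-(2 * x * besselKMoment ν 0 x ^ 2)) x := by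
    intro x hx
    have h := ((hasDerivAt_pow 2 x).mul ((hasDerivAt_besselKMoment ν 1 hx).pow 2)).sub
      (((hasDerivAt_pow 2 x).add_const (ν ^ 2)).mul ((hasDerivAt_besselKMoment ν 0 hx).pow 2))
    refine h.congr_deriv ?_
    have hode := besselKMoment_ode ν hx
    simp only [Pi.pow_apply]
    norm_num
    linear_combination (-2 * besselKMoment ν 1 x) * hode
  have hanti : AntitoneOn D (Ioi 0) := by
    refine antitoneOn_of_deriv_nonpos (convex_Ioi 0)
      (fun x hx => (hderiv x hx).continuousAt.continuousWithinAt) ?_ ?_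
    · rw [interior_Ioi]
      exact fun x hx => (hderiv x hx).differentiableAt.differentiableWithinAt
    · rw [interior_Ioi]
      intro x hx
      rw [(hderiv x hx).deriv]
      have := mem_Ioi.1 hx
      have : 0 ≤ 2 * x * besselKMoment ν 0 x ^ 2 := by positivity
      linarith
  have hdecay : ∀ n : ℕ, n ≤ 1 → Filter.Tendsto (fun x : ℝ => x * besselKMoment ν n x)
      Filter.atTop (nhds 0) := by
    intro n hn
    have hn' : (n : ℝ) ≤ 1 := by exact_mod_cast hn
    obtain ⟨C, hC⟩ := exists_besselKMoment_le (ν := ν) (μ := |ν| + 2) (n := n) (by linarith)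
    have hr : Filter.Tendsto (fun x : ℝ => C * x ^ (-(|ν| + 1))) Filter.atTop (nhds 0) := by
      simpa using (tendsto_rpow_neg_atTop (by positivity : 0 < |ν| + 1)).const_mul C
    refine tendsto_of_tendsto_of_tendsto_of_le_of_le' tendsto_const_nhds hr ?_ ?_
    · filter_upwards [Filter.eventually_gt_atTop 0] with x hx
      exact (mul_pos hx (besselKMoment_pos ν n hx)).le
    · filter_upwards [Filter.eventually_gt_atTop 0] with x hx
      calc x * besselKMoment ν n x ≤ x * (C * x ^ (-(|ν| + 2))) := by
            gcongr
            exact hC x hx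
        _ = C * (x ^ (1 : ℝ) * x ^ (-(|ν| + 2))) := by rw [Real.rpow_one]; ring
        _ = _ := by rw [← Real.rpow_add hx]; ring_nf
  have hlim : Filter.Tendsto D Filter.atTop (nhds 0) := by
    have h0 := hdecay 0 (by norm_num)
    have h0' : Filter.Tendsto (besselKMoment ν 0) Filter.atTop (nhds 0) := by
      refine tendsto_of_tendsto_of_tendsto_of_le_of_le' tendsto_const_nhds h0 ?_ ?_
      · filter_upwards [Filter.eventually_gt_atTop 0] with x hx
        exact (besselKMoment_pos ν 0 hx).le
      · filter_upwards [Filter.eventually_ge_atTop 1] with x hx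
        exact le_mul_of_one_le_left (besselKMoment_pos ν 0 (by linarith)).le hx
    have h := (((hdecay 1 le_rfl).pow 2).sub (h0.pow 2)).sub ((h0'.pow 2).const_mul (ν ^ 2))
    norm_num at h
    refine h.congr fun x => ?_
    simp only [hD]
    ring
  have h0 : 0 ≤ D u := by
    refine le_of_tendsto hlim ?_
    filter_upwards [Filter.eventually_ge_atTop u] with x hx
    exact hanti hu (lt_of_lt_of_le hu hx) hx
  simp only [hD] at h0
  linarith

/-- `-u K_ν'(u) / K_ν(u)` is increasing. -/
lemma monotoneOn_mul_besselKMoment_div (ν : ℝ) :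
    MonotoneOn (fun u => u * besselKMoment ν 1 u / besselKMoment ν 0 u) (Ioi 0) := by
  have hderiv : ∀ x, 0 < x → HasDerivAt
      (fun u => u * besselKMoment ν 1 u / besselKMoment ν 0 u)
      ((x ^ 2 * besselKMoment ν 1 x ^ 2 - (x ^ 2 + ν ^ 2) * besselKMoment ν 0 x ^ 2) /
        (x * besselKMoment ν 0 x ^ 2)) x := by
    intro x hx
    have hK := besselKMoment_pos ν 0 hx
    have h := ((hasDerivAt_id x).mul (hasDerivAt_besselKMoment ν 1 hx)).div
      (hasDerivAt_besselKMoment ν 0 hx) hK.ne'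
    refine h.congr_deriv ?_
    have hode := besselKMoment_ode ν hx
    simp only [Pi.mul_apply, id]
    field_simp
    norm_num
    linear_combination -besselKMoment ν 0 x * hode
  refine monotoneOn_of_deriv_nonneg (convex_Ioi 0)
    (fun x hx => (hderiv x hx).continuousAt.continuousWithinAt) ?_ ?_
  · rw [interior_Ioi]
    exact fun x hx => (hderiv x hx).differentiableAt.differentiableWithinAt
  · rw [interior_Ioi]
    intro x hx
    rw [(hderiv x hx).deriv]
    have := mem_Ioi.1 hx
    have := sq_mul_le_sq_mul_besselKMoment ν (mem_Ioi.1 hx)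
    exact div_nonneg (by linarith) (by positivity)

lemma besselK_pos (ν : ℝ) {u : ℝ} (hu : 0 < u) : 0 < besselK ν u := by
  rw [← besselKMoment_zero]
  exact besselKMoment_pos ν 0 hu

lemma hasDerivAt_besselK (ν : ℝ) {u : ℝ} (hu : 0 < u) :
    HasDerivAt (besselK ν) (-besselKMoment ν 1 u) u := by
  rw [← besselKMoment_zero]
  exact hasDerivAt_besselKMoment ν 0 hu

lemma monotoneOn_besselK_mul_div_besselK (ν : ℝ) {σ : ℝ} (hσ : 0 < σ) (hσ1 : σ ≤ 1) :
    MonotoneOn (fun x => besselK ν (σ * x) / besselK ν x) (Ioi 0) := by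
  have hderiv : ∀ x, 0 < x → HasDerivAt (fun x => besselK ν (σ * x) / besselK ν x)
      ((besselKMoment ν 1 x * besselK ν (σ * x) -
        σ * besselKMoment ν 1 (σ * x) * besselK ν x) / besselK ν x ^ 2) x := by
    intro x hx
    have h1 : HasDerivAt (fun x => besselK ν (σ * x)) (-besselKMoment ν 1 (σ * x) * σ) x :=
      (hasDerivAt_besselK ν (mul_pos hσ hx)).comp x (by simpa using (hasDerivAt_id x).const_mul σ)
    exact (h1.div (hasDerivAt_besselK ν hx) (besselK_pos ν hx).ne').congr_deriv (by ring)
  refine monotoneOn_of_deriv_nonneg (convex_Ioi 0)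
    (fun x hx => (hderiv x hx).continuousAt.continuousWithinAt) ?_ ?_
  · rw [interior_Ioi]
    exact fun x hx => (hderiv x hx).differentiableAt.differentiableWithinAt
  · rw [interior_Ioi]
    intro x hx
    rw [(hderiv x hx).deriv]
    have hx := mem_Ioi.1 hx
    have h := monotoneOn_mul_besselKMoment_div ν (mem_Ioi.2 (mul_pos hσ hx)) (mem_Ioi.2 hx)
      (mul_le_of_le_one_left hx.le hσ1)
    simp only [besselKMoment_zero] at h
    rw [div_le_div_iff₀ (besselK_pos ν (mul_pos hσ hx)) (besselK_pos ν hx)] at h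
    refine div_nonneg (nonneg_of_mul_nonneg_right ?_ hx) (by positivity)
    linarith

lemma besselK_mul_besselK_le (ν : ℝ) {σ x y : ℝ} (hσ : 0 < σ) (hσ1 : σ ≤ 1) (hx : 0 < x)
    (hxy : x ≤ y) : besselK ν (σ * x) * besselK ν y ≤ besselK ν (σ * y) * besselK ν x := by
  have hy := hx.trans_le hxy
  have h := monotoneOn_besselK_mul_div_besselK ν hσ hσ1 (mem_Ioi.2 hx) (mem_Ioi.2 hy) hxy
  exact (div_le_div_iff₀ (besselK_pos ν hx) (besselK_pos ν hy)).1 h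

section GammaGamma

variable {a b α : ℝ}

lemma besselK_arg_pos (ha : 0 < a) (hb : 0 < b) (hα : 0 < α) {u : ℝ} (hu : 0 < u) :
    0 < 2 * Real.sqrt (a * b * u / α) := by positivity

lemma gammaGammaPdf_pos (ha : 0 < a) (hb : 0 < b) (hα : 0 < α) {u : ℝ} (hu : 0 < u) :
    0 < gammaGammaPdf a b α u := by
  unfold gammaGammaPdf
  have := Real.Gamma_pos_of_pos ha
  have := Real.Gamma_pos_of_pos hb
  have := besselK_pos (a - b) (besselK_arg_pos ha hb hα hu)
  positivity

lemma continuousOn_gammaGammaPdf (ha : 0 < a) (hb : 0 < b) (hα : 0 < α) :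
    ContinuousOn (gammaGammaPdf a b α) (Ioi 0) := by
  intro u hu
  have hu := mem_Ioi.1 hu
  have h1 : ContinuousAt (fun u : ℝ => u ^ ((a + b) / 2 - 1)) u :=
    Real.continuousAt_rpow_const _ _ (Or.inl hu.ne')
  have h2 : ContinuousAt (fun u : ℝ => 2 * Real.sqrt (a * b * u / α)) u := by fun_prop
  have h3 : ContinuousAt (fun u => besselK (a - b) (2 * Real.sqrt (a * b * u / α))) u :=
    ContinuousAt.comp (f := fun u : ℝ => 2 * Real.sqrt (a * b * u / α))
      (hasDerivAt_besselK (a - b) (besselK_arg_pos ha hb hα hu)).continuousAt h2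
  exact (((continuousAt_const.mul h1).div_const _).mul h3).continuousWithinAt

lemma intervalIntegrable_gammaGammaPdf (ha : 0 < a) (hb : 0 < b) (hα : 0 < α) {u : ℝ}
    (hu : 0 < u) : IntervalIntegrable (gammaGammaPdf a b α) volume 0 u := by
  have hab : |a - b| < a + b := abs_lt.2 ⟨by linarith, by linarith⟩
  obtain ⟨μ, hμ1, hμ2⟩ := exists_between hab
  obtain ⟨C, hC⟩ := exists_besselKMoment_le (ν := a - b) (μ := μ) (n := 0) (by simpa using hμ1)
  have hΓa := Real.Gamma_pos_of_pos ha
  have hΓb := Real.Gamma_pos_of_pos hb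
  set A := 2 * (a * b) ^ ((a + b) / 2) / (Real.Gamma a * Real.Gamma b * α ^ ((a + b) / 2))
    with hA
  have hA0 : 0 < A := by positivity
  set B := C * (2 * Real.sqrt (a * b / α)) ^ (-μ) with hB
  have hbound : ∀ t, 0 < t →
      gammaGammaPdf a b α t ≤ A * B * t ^ ((a + b) / 2 - 1 - μ / 2) := by
    intro t ht
    have hK := hC _ (besselK_arg_pos ha hb hα ht)
    rw [besselKMoment_zero] at hK
    have hs : (2 * Real.sqrt (a * b * t / α)) ^ (-μ) =
        (2 * Real.sqrt (a * b / α)) ^ (-μ) * t ^ (-(μ / 2)) := by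
      rw [show a * b * t / α = a * b / α * t by ring, Real.sqrt_mul (by positivity), ← mul_assoc,
        Real.mul_rpow (by positivity) (by positivity), Real.sqrt_eq_rpow t,
        ← Real.rpow_mul ht.le]
      ring_nf
    calc gammaGammaPdf a b α t
        = A * t ^ ((a + b) / 2 - 1) * besselK (a - b) (2 * Real.sqrt (a * b * t / α)) := by
          rw [gammaGammaPdf, hA]
          ring
      _ ≤ A * t ^ ((a + b) / 2 - 1) * (C * (2 * Real.sqrt (a * b * t / α)) ^ (-μ)) := by gcongr
      _ = A * B * (t ^ ((a + b) / 2 - 1) * t ^ (-(μ / 2))) := by rw [hs, hB]; ring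
      _ = _ := by rw [← Real.rpow_add ht, ← sub_eq_add_neg]
  refine IntervalIntegrable.mono_fun'
    ((intervalIntegral.intervalIntegrable_rpow'
      (by linarith : -1 < (a + b) / 2 - 1 - μ / 2)).const_mul (A * B)) ?_ ?_
  · rw [uIoc_of_le hu.le]
    exact ((continuousOn_gammaGammaPdf ha hb hα).mono fun t ht => ht.1).aestronglyMeasurable
      measurableSet_Ioc
  · rw [uIoc_of_le hu.le]
    filter_upwards [ae_restrict_mem measurableSet_Ioc] with t ht
    rw [Real.norm_of_nonneg (gammaGammaPdf_pos ha hb hα ht.1).le]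
    exact hbound t ht.1

lemma gammaGammaCdf_pos (ha : 0 < a) (hb : 0 < b) (hα : 0 < α) {u : ℝ} (hu : 0 < u) :
    0 < gammaGammaCdf a b α u :=
  intervalIntegral.intervalIntegral_pos_of_pos_on (intervalIntegrable_gammaGammaPdf ha hb hα hu)
    (fun _ ht => gammaGammaPdf_pos ha hb hα ht.1) hu

lemma hasDerivAt_gammaGammaCdf (ha : 0 < a) (hb : 0 < b) (hα : 0 < α) {u : ℝ} (hu : 0 < u) :
    HasDerivAt (gammaGammaCdf a b α) (gammaGammaPdf a b α u) u :=
  intervalIntegral.integral_hasDerivAt_right (intervalIntegrable_gammaGammaPdf ha hb hα hu)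
    ((continuousOn_gammaGammaPdf ha hb hα).stronglyMeasurableAtFilter isOpen_Ioi u hu)
    ((continuousOn_gammaGammaPdf ha hb hα).continuousAt (Ioi_mem_nhds hu))

lemma gammaGammaCdf_eq_mul_integral (a b α u : ℝ) :
    gammaGammaCdf a b α u = u * ∫ s in (0 : ℝ)..1, gammaGammaPdf a b α (u * s) := by
  rw [intervalIntegral.mul_integral_comp_mul_left, mul_zero, mul_one, gammaGammaCdf]

lemma intervalIntegrable_gammaGammaPdf_comp_mul_left (ha : 0 < a) (hb : 0 < b) (hα : 0 < α)
    {u : ℝ} (hu : 0 < u) :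
    IntervalIntegrable (fun s => gammaGammaPdf a b α (u * s)) volume 0 1 := by
  have h := (intervalIntegrable_gammaGammaPdf ha hb hα hu).comp_mul_left (c := u)
  rwa [zero_div, div_self hu.ne'] at h

lemma gammaGammaPdf_mul_le (ha : 0 < a) (hb : 0 < b) (hα : 0 < α) {s u v : ℝ} (hs : 0 < s)
    (hs1 : s ≤ 1) (hu : 0 < u) (huv : u ≤ v) :
    gammaGammaPdf a b α (u * s) * gammaGammaPdf a b α v ≤
      gammaGammaPdf a b α (v * s) * gammaGammaPdf a b α u := by
  have hv := hu.trans_le huv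
  have hK := besselK_mul_besselK_le (a - b) (Real.sqrt_pos.2 hs) (Real.sqrt_le_one.2 hs1)
    (besselK_arg_pos ha hb hα hu)
    (by gcongr : 2 * Real.sqrt (a * b * u / α) ≤ 2 * Real.sqrt (a * b * v / α))
  have hsqrt : ∀ x : ℝ, 2 * Real.sqrt (a * b * (x * s) / α) =
      Real.sqrt s * (2 * Real.sqrt (a * b * x / α)) := by
    intro x
    rw [show a * b * (x * s) / α = s * (a * b * x / α) by ring, Real.sqrt_mul hs.le]
    ring
  rw [← hsqrt, ← hsqrt] at hK
  have hΓa := Real.Gamma_pos_of_pos ha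
  have hΓb := Real.Gamma_pos_of_pos hb
  have hM : 0 ≤ (2 * (a * b) ^ ((a + b) / 2) /
      (Real.Gamma a * Real.Gamma b * α ^ ((a + b) / 2))) ^ 2 *
      (u ^ ((a + b) / 2 - 1) * v ^ ((a + b) / 2 - 1) * s ^ ((a + b) / 2 - 1)) := by positivity
  have h := mul_le_mul_of_nonneg_left hK hM
  simp only [gammaGammaPdf]
  rw [Real.mul_rpow hu.le hs.le, Real.mul_rpow hv.le hs.le]
  exact (by ring : _ = _).trans_le (h.trans_eq (by ring))

/-- The elasticity `u f(u) / F(u)` of the distribution function is decreasing. -/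
lemma mul_gammaGammaPdf_mul_gammaGammaCdf_le (ha : 0 < a) (hb : 0 < b) (hα : 0 < α) {u v : ℝ}
    (hu : 0 < u) (huv : u ≤ v) :
    v * gammaGammaPdf a b α v * gammaGammaCdf a b α u ≤
      u * gammaGammaPdf a b α u * gammaGammaCdf a b α v := by
  have hv := hu.trans_le huv
  have h : (∫ s in (0 : ℝ)..1, gammaGammaPdf a b α (u * s)) * gammaGammaPdf a b α v ≤
      (∫ s in (0 : ℝ)..1, gammaGammaPdf a b α (v * s)) * gammaGammaPdf a b α u := by
    rw [← intervalIntegral.integral_mul_const, ← intervalIntegral.integral_mul_const]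
    exact intervalIntegral.integral_mono_on_of_le_Ioo zero_le_one
      ((intervalIntegrable_gammaGammaPdf_comp_mul_left ha hb hα hu).mul_const _)
      ((intervalIntegrable_gammaGammaPdf_comp_mul_left ha hb hα hv).mul_const _)
      fun s hs => gammaGammaPdf_mul_le ha hb hα hs.1 hs.2.le hu huv
  rw [gammaGammaCdf_eq_mul_integral a b α u, gammaGammaCdf_eq_mul_integral a b α v]
  linarith [mul_le_mul_of_nonneg_left h (mul_pos hu hv).le]

lemma strictConcaveOn_log_gammaGammaCdf (ha : 0 < a) (hb : 0 < b) (hα : 0 < α) :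
    StrictConcaveOn ℝ (Ioi 0) (fun u : ℝ => Real.log (gammaGammaCdf a b α u)) := by
  have hderiv : ∀ u, 0 < u → HasDerivAt (fun u : ℝ => Real.log (gammaGammaCdf a b α u))
      (gammaGammaPdf a b α u / gammaGammaCdf a b α u) u := fun u hu =>
    (hasDerivAt_gammaGammaCdf ha hb hα hu).log (gammaGammaCdf_pos ha hb hα hu).ne'
  refine StrictAntiOn.strictConcaveOn_of_deriv (convex_Ioi 0)
    (fun u hu => (hderiv u hu).continuousAt.continuousWithinAt) ?_
  rw [interior_Ioi]
  intro u hu v hv huv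
  rw [(hderiv u hu).deriv, (hderiv v hv).deriv,
    div_lt_div_iff₀ (gammaGammaCdf_pos ha hb hα hv) (gammaGammaCdf_pos ha hb hα hu)]
  have hu := mem_Ioi.1 hu
  have h := mul_gammaGammaPdf_mul_gammaGammaCdf_le ha hb hα hu huv.le
  have hpos := mul_pos (gammaGammaPdf_pos ha hb hα hv) (gammaGammaCdf_pos ha hb hα hu)
  refine lt_of_mul_lt_mul_left ?_ hu.le
  calc _ < v * (gammaGammaPdf a b α v * gammaGammaCdf a b α u) :=
        mul_lt_mul_of_pos_right huv hpos
    _ ≤ _ := by linarith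

end GammaGamma

theorem gammaGammaCdf_strictLogConcave (a b α : ℝ) (ha : 0 < a) (hb : 0 < b) (hα : 0 < α) :
    StrictConcaveOn ℝ (Ioi 0) (fun u : ℝ => Real.log (gammaGammaCdf a b α u)) ∧
    ∀ l ∈ Ioo (0 : ℝ) 1, ∀ u₁ ∈ Ioi (0 : ℝ), ∀ u₂ ∈ Ioi (0 : ℝ), u₁ ≠ u₂ →
      gammaGammaCdf a b α u₁ ^ l * gammaGammaCdf a b α u₂ ^ (1 - l) <
        gammaGammaCdf a b α (l * u₁ + (1 - l) * u₂) := by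
  have hconc := strictConcaveOn_log_gammaGammaCdf ha hb hα
  refine ⟨hconc, fun l hl u₁ hu₁ u₂ hu₂ hne => ?_⟩
  have hl' : 0 < 1 - l := sub_pos.2 hl.2
  have hlt := hconc.2 hu₁ hu₂ hne hl.1 hl' (by ring)
  have hF₁ := gammaGammaCdf_pos ha hb hα (mem_Ioi.1 hu₁)
  have hF₂ := gammaGammaCdf_pos ha hb hα (mem_Ioi.1 hu₂)
  have hF := gammaGammaCdf_pos ha hb hα
    (add_pos (mul_pos hl.1 (mem_Ioi.1 hu₁)) (mul_pos hl' (mem_Ioi.1 hu₂)))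
  simp only [smul_eq_mul] at hlt
  rw [← Real.log_lt_log_iff (by positivity) hF, Real.log_mul (by positivity) (by positivity),
    Real.log_rpow hF₁, Real.log_rpow hF₂]
  exact hlt
end
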